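/- For every y > 1, the limit lim_{n→∞} (1/n) log B_n(y) exists and equals log(y²+1) − log y. -/

import Mathlib

open Finset Filter

attribute [local instance] Classical.propDecidable

/-- Height (second coordinate) of a binomial path after `i` steps, starting at height `c`;
steps are encoded by `s : Fin n → Bool` (`true` = up step `(1,1)`, `false` = down step `(1,-1)`).
The path visits the points `(x₀ + i, hgt c s i)` for `0 ≤ i ≤ n`. -/
def hgt {n : ℕ} (c : ℤ) (s : Fin n → Bool) (i : ℕ) : ℤ :=
  c + ∑ j ∈ Finset.range i, (if h : j < n then (if s ⟨j, h⟩ then (1 : ℤ) else -1) else 0)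

/-- The path lies in the upper half-plane (all second coordinates ≥ 0). -/
def InUHP {n : ℕ} (c : ℤ) (s : Fin n → Bool) : Prop :=
  ∀ i ≤ n, 0 ≤ hgt c s i

/-- The number of vertices of the path with second coordinate 0. -/
def visits {n : ℕ} (c : ℤ) (s : Fin n → Bool) : ℕ :=
  ((Finset.range (n + 1)).filter (fun i => hgt c s i = 0)).card

/-- `b_{n,h}`: the number of bridges of length `n` and height `h`, i.e. binomial paths
starting at `(0,0)` whose second coordinates satisfy
`0 = y(ω₀) < y(ωᵢ) ≤ y(ωₙ) = h` for all `1 ≤ i ≤ n-1`. -/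
noncomputable def bridgeCount (n h : ℕ) : ℕ :=
  ((Finset.univ : Finset (Fin n → Bool)).filter
    (fun s => hgt 0 s n = (h : ℤ) ∧
      ∀ i, 1 ≤ i → i ≤ n - 1 → 0 < hgt 0 s i ∧ hgt 0 s i ≤ (h : ℤ))).card

/-- `B_n(y) = Σ_{h=1}^{n} b_{n,h} y^h`. -/
noncomputable def Bn (n : ℕ) (y : ℝ) : ℝ :=
  ∑ h ∈ Finset.Icc 1 n, (bridgeCount n h : ℝ) * y ^ h


/-- The weight of a path: `y` for each up step, `y⁻¹` for each down step. -/
noncomputable def wt (y : ℝ) {n : ℕ} (s : Fin n → Bool) : ℝ :=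
  ∏ j, (if s j then y else y⁻¹)

lemma hgt_zero {n : ℕ} (c : ℤ) (s : Fin n → Bool) : hgt c s 0 = c := by simp [hgt]

lemma hgt_shift {n : ℕ} (c : ℤ) (s : Fin n → Bool) (i : ℕ) : hgt c s i = c + hgt 0 s i := by
  simp [hgt]

lemma hgt_cons {n : ℕ} (c : ℤ) (b : Bool) (s : Fin n → Bool) (i : ℕ) :
    hgt c (Fin.cons b s : Fin (n + 1) → Bool) (i + 1)
      = hgt (c + (if b then 1 else -1)) s i := by
  unfold hgt
  rw [Finset.sum_range_succ', add_comm (Finset.sum _ _), ← add_assoc]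
  congr 1
  apply Finset.sum_congr rfl
  intro j _
  by_cases h : j < n
  · have h' : j + 1 < n + 1 := by omega
    rw [dif_pos h, dif_pos h']
    rfl
  · have h' : ¬ (j + 1 < n + 1) := by omega
    rw [dif_neg h, dif_neg h']

lemma hgt_snoc_le {n : ℕ} (c : ℤ) (b : Bool) (s : Fin n → Bool) (i : ℕ) (hi : i ≤ n) :
    hgt c (Fin.snoc s b : Fin (n + 1) → Bool) i = hgt c s i := by
  unfold hgt
  congr 1
  apply Finset.sum_congr rfl
  intro j hj
  have h : j < n := by have := Finset.mem_range.1 hj; omega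
  have h' : j < n + 1 := by omega
  rw [dif_pos h, dif_pos h']
  have : (Fin.snoc s b : Fin (n + 1) → Bool) ⟨j, h'⟩ = s ⟨j, h⟩ :=
    Fin.snoc_castSucc (α := fun _ => Bool) b s ⟨j, h⟩
  rw [this]

lemma hgt_succ {n : ℕ} (c : ℤ) (s : Fin n → Bool) (i : ℕ) (hi : i < n) :
    hgt c s (i + 1) = hgt c s i + (if s ⟨i, hi⟩ then 1 else -1) := by
  unfold hgt
  rw [Finset.sum_range_succ, dif_pos hi, add_assoc]

lemma hgt_snoc_last {n : ℕ} (c : ℤ) (b : Bool) (s : Fin n → Bool) :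
    hgt c (Fin.snoc s b : Fin (n + 1) → Bool) (n + 1)
      = hgt c s n + (if b then 1 else -1) := by
  rw [hgt_succ _ _ _ (Nat.lt_succ_self n), hgt_snoc_le _ _ _ _ le_rfl]
  have : (Fin.snoc s b : Fin (n + 1) → Bool) ⟨n, Nat.lt_succ_self n⟩ = b :=
    Fin.snoc_last (α := fun _ => Bool) b s
  rw [this]

lemma path_sum_cons {n : ℕ} (F : (Fin (n + 1) → Bool) → ℝ) :
    ∑ s, F s = ∑ s : Fin n → Bool, F (Fin.cons true s) + ∑ s : Fin n → Bool, F (Fin.cons false s) := by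
  rw [← (Fin.consEquiv (fun _ : Fin (n + 1) => Bool)).sum_comp, Fintype.sum_prod_type]
  simp [Fin.consEquiv]

lemma path_sum_snoc {n : ℕ} (F : (Fin (n + 1) → Bool) → ℝ) :
    ∑ s, F s = ∑ s : Fin n → Bool, F (Fin.snoc s true) + ∑ s : Fin n → Bool, F (Fin.snoc s false) := by
  rw [← (Fin.snocEquiv (fun _ : Fin (n + 1) => Bool)).sum_comp, Fintype.sum_prod_type]
  simp [Fin.snocEquiv]

lemma wt_cons (y : ℝ) {n : ℕ} (b : Bool) (s : Fin n → Bool) :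
    wt y (Fin.cons b s : Fin (n + 1) → Bool) = (if b then y else y⁻¹) * wt y s := by
  simp [wt, Fin.prod_univ_succ]

lemma wt_snoc (y : ℝ) {n : ℕ} (b : Bool) (s : Fin n → Bool) :
    wt y (Fin.snoc s b : Fin (n + 1) → Bool) = (if b then y else y⁻¹) * wt y s := by
  simp [wt, Fin.prod_univ_castSucc, mul_comm]

lemma wt_pos {y : ℝ} (hy : 0 < y) {n : ℕ} (s : Fin n → Bool) : 0 < wt y s := by
  unfold wt
  apply Finset.prod_pos
  intro j _
  split_ifs <;> positivity

lemma wt_eq {y : ℝ} (hy : 0 < y) {n : ℕ} (s : Fin n → Bool) : wt y s = y ^ (hgt 0 s n) := by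
  induction n with
  | zero => simp [wt, hgt]
  | succ n ih =>
    rw [← Fin.cons_self_tail s, wt_cons, hgt_cons, hgt_shift, ih, zpow_add₀ hy.ne']
    congr 1
    split_ifs <;> simp

lemma sum_wt (y : ℝ) (n : ℕ) : ∑ s : Fin n → Bool, wt y s = (y + y⁻¹) ^ n := by
  induction n with
  | zero => simp [wt]
  | succ n ih =>
    rw [path_sum_cons]
    simp only [wt_cons, ← Finset.mul_sum, ih]
    simp
    ring

lemma wt_mod (y : ℝ) {n : ℕ} (a b : Fin n → Bool) :
    wt y a * wt y b = wt y (a ⊓ b) * wt y (a ⊔ b) := by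
  unfold wt
  rw [← Finset.prod_mul_distrib, ← Finset.prod_mul_distrib]
  apply Finset.prod_congr rfl
  intro j _
  simp only [Pi.inf_apply, Pi.sup_apply]
  rcases Bool.eq_false_or_eq_true (a j) with ha | ha <;>
    rcases Bool.eq_false_or_eq_true (b j) with hb | hb <;> simp [ha, hb, mul_comm]

lemma hgt_incr {n : ℕ} {s t : Fin n → Bool} (h : s ≤ t) {i j : ℕ} (hij : i ≤ j) (hj : j ≤ n) :
    hgt 0 s j - hgt 0 s i ≤ hgt 0 t j - hgt 0 t i := by
  induction j, hij using Nat.le_induction with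
  | base => simp
  | succ j hij ih =>
    have h1 := ih (by omega)
    rw [hgt_succ _ s j (by omega), hgt_succ _ t j (by omega)]
    have h2 := h ⟨j, by omega⟩
    have h3 : (if s ⟨j, by omega⟩ then (1 : ℤ) else -1) ≤ (if t ⟨j, by omega⟩ then 1 else -1) := by
      revert h2
      cases s ⟨j, by omega⟩ <;> cases t ⟨j, by omega⟩ <;> simp
    linarith

/-- The path stays positive after time `0`. -/
def EvA {n : ℕ} (k : ℤ) (s : Fin n → Bool) : Prop :=
  ∀ i, 1 ≤ i → i ≤ n → 0 < k + hgt 0 s i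

/-- The final height exceeds every height minus `k`. -/
def EvB {n : ℕ} (k : ℤ) (s : Fin n → Bool) : Prop :=
  ∀ i, i ≤ n → 0 < k + (hgt 0 s n - hgt 0 s i)

lemma evA_cons {n : ℕ} {k : ℤ} (b : Bool) (s : Fin n → Bool)
    (h0 : 0 < k + (if b then 1 else -1)) (h : EvA (k + (if b then 1 else -1)) s) :
    EvA k (Fin.cons b s : Fin (n + 1) → Bool) := by
  intro i h1 h2
  obtain ⟨i, rfl⟩ : ∃ j, i = j + 1 := ⟨i - 1, by omega⟩
  rw [hgt_cons, hgt_shift]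
  rcases Nat.eq_zero_or_pos i with rfl | hi
  · rw [hgt_zero]; linarith
  · have := h i hi (by omega)
    linarith

lemma evB_snoc {n : ℕ} {k : ℤ} (hk : 0 < k) (b : Bool) (s : Fin n → Bool)
    (h : EvB (k + (if b then 1 else -1)) s) :
    EvB k (Fin.snoc s b : Fin (n + 1) → Bool) := by
  intro i h2
  rcases Nat.lt_or_ge n i with hi | hi
  · obtain rfl : i = n + 1 := by omega
    linarith
  · rw [hgt_snoc_last, hgt_snoc_le _ _ _ _ hi]
    have := h i hi
    linarith

lemma harm {y : ℝ} (hy : 0 < y) (k : ℕ) :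
    (1 - (y⁻¹ ^ 2) ^ (k + 1)) * (y + y⁻¹)
      = y * (1 - (y⁻¹ ^ 2) ^ (k + 2)) + y⁻¹ * (1 - (y⁻¹ ^ 2) ^ k) := by
  have : y * y⁻¹ = 1 := mul_inv_cancel₀ hy.ne'
  generalize y⁻¹ = z at *
  rw [pow_succ (z ^ 2) (k + 1), pow_succ (z ^ 2) k]
  linear_combination ((z ^ 2) ^ k * (z ^ 3 - z)) * this

lemma sumA {y : ℝ} (hy : 1 < y) (n : ℕ) : ∀ k : ℕ,
    (1 - (y⁻¹ ^ 2) ^ (k + 1)) * (y + y⁻¹) ^ n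
      ≤ ∑ s : Fin n → Bool, wt y s * (if EvA (k + 1) s then 1 else 0) := by
  have hy0 : 0 < y := by linarith
  have hyi : 0 < y⁻¹ := by positivity
  induction n with
  | zero =>
    intro k
    have : (0:ℝ) ≤ (y⁻¹ ^ 2) ^ (k + 1) := by positivity
    have h : ∀ s : Fin 0 → Bool, EvA ((k : ℤ) + 1) s := fun s i h1 h2 => by omega
    simp [h, wt]
    simpa using this
  | succ n ih =>
    intro k
    rw [pow_succ' (y + y⁻¹), ← mul_assoc, harm hy0, add_mul, path_sum_cons]
    simp only [wt_cons, mul_assoc, ← Finset.mul_sum]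
    refine add_le_add ?_ ?_
    · refine mul_le_mul_of_nonneg_left ((ih (k + 1)).trans ?_) hy0.le
      refine Finset.sum_le_sum fun s _ => mul_le_mul_of_nonneg_left ?_ (wt_pos hy0 s).le
      by_cases h : EvA (((k + 1 : ℕ) : ℤ) + 1) s
      · have : EvA ((k : ℤ) + 1) (Fin.cons true s : Fin (n + 1) → Bool) :=
          evA_cons _ _ (by simp; omega) (by simpa using h)
        rw [if_pos this, if_pos h]
      · rw [if_neg h]; split_ifs <;> simp
    · refine mul_le_mul_of_nonneg_left ?_ hyi.le
      rcases k with _ | k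
      · simp only [pow_zero, sub_self, zero_mul]
        refine Finset.sum_nonneg fun s _ => mul_nonneg (wt_pos hy0 s).le ?_
        split_ifs <;> simp
      refine (ih k).trans ?_
      refine Finset.sum_le_sum fun s _ => mul_le_mul_of_nonneg_left ?_ (wt_pos hy0 s).le
      by_cases h : EvA ((k : ℤ) + 1) s
      · have : EvA (((k + 1 : ℕ) : ℤ) + 1) (Fin.cons false s : Fin (n + 1) → Bool) :=
          evA_cons _ _ (by simp) (by simpa using h)
        rw [if_pos this, if_pos h]
      · rw [if_neg h]; split_ifs <;> simp

lemma sumB {y : ℝ} (hy : 1 < y) (n : ℕ) : ∀ k : ℕ,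
    (1 - (y⁻¹ ^ 2) ^ (k + 1)) * (y + y⁻¹) ^ n
      ≤ ∑ s : Fin n → Bool, wt y s * (if EvB (k + 1) s then 1 else 0) := by
  have hy0 : 0 < y := by linarith
  have hyi : 0 < y⁻¹ := by positivity
  induction n with
  | zero =>
    intro k
    have : (0:ℝ) ≤ (y⁻¹ ^ 2) ^ (k + 1) := by positivity
    have h : ∀ s : Fin 0 → Bool, EvB ((k : ℤ) + 1) s := fun s i h2 => by
      obtain rfl : i = 0 := by omega
      simp
    simp [h, wt]
    simpa using this
  | succ n ih =>
    intro k
    rw [pow_succ' (y + y⁻¹), ← mul_assoc, harm hy0, add_mul, path_sum_snoc]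
    simp only [wt_snoc, mul_assoc, ← Finset.mul_sum]
    refine add_le_add ?_ ?_
    · refine mul_le_mul_of_nonneg_left ((ih (k + 1)).trans ?_) hy0.le
      refine Finset.sum_le_sum fun s _ => mul_le_mul_of_nonneg_left ?_ (wt_pos hy0 s).le
      by_cases h : EvB (((k + 1 : ℕ) : ℤ) + 1) s
      · have : EvB ((k : ℤ) + 1) (Fin.snoc s true : Fin (n + 1) → Bool) :=
          evB_snoc (by omega) _ _ (by simpa using h)
        rw [if_pos this, if_pos h]
      · rw [if_neg h]; split_ifs <;> simp
    · refine mul_le_mul_of_nonneg_left ?_ hyi.le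
      rcases k with _ | k
      · simp only [pow_zero, sub_self, zero_mul]
        refine Finset.sum_nonneg fun s _ => mul_nonneg (wt_pos hy0 s).le ?_
        split_ifs <;> simp
      refine (ih k).trans ?_
      refine Finset.sum_le_sum fun s _ => mul_le_mul_of_nonneg_left ?_ (wt_pos hy0 s).le
      by_cases h : EvB ((k : ℤ) + 1) s
      · have : EvB (((k + 1 : ℕ) : ℤ) + 1) (Fin.snoc s false : Fin (n + 1) → Bool) :=
          evB_snoc (by omega) _ _ (by simpa using h)
        rw [if_pos this, if_pos h]
      · rw [if_neg h]; split_ifs <;> simp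

lemma sumA0 {y : ℝ} (hy : 1 < y) (n : ℕ) :
    y * ((1 - y⁻¹ ^ 2) * (y + y⁻¹) ^ n)
      ≤ ∑ s : Fin (n + 1) → Bool, wt y s * (if EvA 0 s then 1 else 0) := by
  have hy0 : 0 < y := by linarith
  have hyi : 0 < y⁻¹ := by positivity
  rw [path_sum_cons]
  simp only [wt_cons, mul_assoc, ← Finset.mul_sum]
  have h2 : 0 ≤ ∑ s : Fin n → Bool,
      wt y s * (if EvA 0 (Fin.cons false s : Fin (n + 1) → Bool) then (1 : ℝ) else 0) := by
    refine Finset.sum_nonneg fun s _ => mul_nonneg (wt_pos hy0 s).le ?_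
    split_ifs <;> simp
  have h1 := sumA hy n 0
  refine le_add_of_le_of_nonneg ?_ (mul_nonneg (by simpa using hy0.le) h2)
  refine mul_le_mul_of_nonneg_left ((le_of_eq (by simp)).trans (h1.trans ?_)) (by simpa using hy0.le)
  refine Finset.sum_le_sum fun s _ => mul_le_mul_of_nonneg_left ?_ (wt_pos hy0 s).le
  by_cases h : EvA (((0 : ℕ) : ℤ) + 1) s
  · have : EvA 0 (Fin.cons true s : Fin (n + 1) → Bool) :=
      evA_cons _ _ (by simp) (by simpa using h)
    rw [if_pos this, if_pos h]
  · rw [if_neg h]; split_ifs <;> simp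

lemma hgt_le {n : ℕ} (s : Fin n → Bool) : ∀ i ≤ n, hgt 0 s i ≤ i := by
  intro i
  induction i with
  | zero => simp [hgt]
  | succ i ih =>
    intro hi
    have := ih (by omega)
    rw [hgt_succ _ _ _ (by omega)]
    push_cast
    split_ifs <;> linarith

lemma Bn_eq {y : ℝ} (hy : 0 < y) (n : ℕ) (hn : 1 ≤ n) :
    Bn n y = ∑ s : Fin n → Bool, wt y s * (if EvA 0 s ∧ EvB 1 s then 1 else 0) := by
  unfold Bn bridgeCount
  simp only [Finset.card_filter, Nat.cast_sum, Finset.sum_mul]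
  rw [Finset.sum_comm]
  refine Finset.sum_congr rfl fun s _ => ?_
  by_cases h : EvA 0 s ∧ EvB 1 s
  · rw [if_pos h]
    obtain ⟨hA, hB⟩ := h
    have h1 : 0 < hgt 0 s n := by simpa using hA n hn le_rfl
    have h2 := hgt_le s n le_rfl
    obtain ⟨m, hm⟩ := Int.eq_ofNat_of_zero_le h1.le
    rw [Finset.sum_eq_single m]
    · rw [if_pos, wt_eq hy, hm]
      · simp
      · refine ⟨hm, fun i hi hi' => ⟨by simpa using hA i hi (by omega), ?_⟩⟩
        have := hB i (by omega)
        omega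
    · intro b _ hb
      rw [if_neg]
      · simp
      · rintro ⟨h3, _⟩
        apply hb
        omega
    · intro h3
      exact absurd (Finset.mem_Icc.2 ⟨by omega, by omega⟩) h3
  · rw [if_neg h, mul_zero]
    refine Finset.sum_eq_zero fun m hm => ?_
    rw [if_neg]
    · simp
    · rintro ⟨h3, h4⟩
      have hm1 := (Finset.mem_Icc.1 hm).1
      apply h
      constructor
      · intro i hi hi'
        rcases Nat.lt_or_ge i n with h5 | h5
        · have := (h4 i hi (by omega)).1
          omega
        · obtain rfl : i = n := by omega
          omega
      · intro i hi
        rcases Nat.lt_or_ge i n with h5 | h5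
        · rcases Nat.eq_zero_or_pos i with rfl | h6
          · rw [hgt_zero]; omega
          · have := (h4 i h6 (by omega)).2
            omega
        · obtain rfl : i = n := by omega
          omega

lemma ind_mono {n : ℕ} (P : (Fin n → Bool) → Prop) (h : ∀ s t, s ≤ t → P s → P t) :
    Monotone (fun s => if P s then (1 : ℝ) else 0) := by
  intro s t hst
  by_cases hs : P s
  · simp [hs, h s t hst hs]
  · simp only [if_neg hs]; split_ifs <;> simp

lemma Bn_upper {y : ℝ} (hy : 1 < y) (n : ℕ) (hn : 1 ≤ n) : Bn n y ≤ (y + y⁻¹) ^ n := by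
  have hy0 : 0 < y := by linarith
  rw [Bn_eq hy0 n hn, ← sum_wt]
  refine Finset.sum_le_sum fun s _ => ?_
  have := wt_pos hy0 s
  split_ifs <;> simp [this.le]

lemma Bn_lower {y : ℝ} (hy : 1 < y) (n : ℕ) (hn : 1 ≤ n) :
    (y * (1 - y⁻¹ ^ 2) ^ 2 / (y + y⁻¹)) * (y + y⁻¹) ^ n ≤ Bn n y := by
  have hy0 : 0 < y := by linarith
  have hyi : 0 < y⁻¹ := by positivity
  have hr : 0 < 1 - y⁻¹ ^ 2 := by
    have : y⁻¹ < 1 := inv_lt_one_of_one_lt₀ hy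
    nlinarith
  obtain ⟨n, rfl⟩ : ∃ m, n = m + 1 := ⟨n - 1, by omega⟩
  have hA := sumA0 hy n
  have hB := sumB hy (n + 1) 0
  have hF := fkg (α := Fin (n + 1) → Bool) (β := ℝ) (μ := fun s => wt y s)
    (f := fun s => if EvA 0 s then (1 : ℝ) else 0) (g := fun s => if EvB 1 s then (1 : ℝ) else 0)
    (fun s => (wt_pos hy0 s).le) (fun s => by dsimp; split_ifs <;> simp)
    (fun s => by dsimp; split_ifs <;> simp)
    (ind_mono _ (by
      intro s t hst h i h1 h2
      have := h i h1 h2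
      have h3 := hgt_incr hst (Nat.zero_le i) h2
      simp only [hgt_zero] at h3
      linarith))
    (ind_mono _ (by
      intro s t hst h i h1
      have := h i h1
      have h3 := hgt_incr hst h1 le_rfl
      linarith))
    (fun a b => (wt_mod y a b).le)
  rw [sum_wt] at hF
  have hE : ∑ s : Fin (n + 1) → Bool, wt y s *
      ((if EvA 0 s then (1 : ℝ) else 0) * (if EvB 1 s then (1 : ℝ) else 0)) = Bn (n + 1) y := by
    rw [Bn_eq hy0 _ hn]
    refine Finset.sum_congr rfl fun s _ => ?_
    by_cases h1 : EvA 0 s <;> by_cases h2 : EvB 1 s <;> simp [h1, h2]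
  rw [hE] at hF
  have hB' : (1 - y⁻¹ ^ 2) * (y + y⁻¹) ^ (n + 1) ≤
      ∑ s : Fin (n + 1) → Bool, wt y s * (if EvB 1 s then (1 : ℝ) else 0) := by
    simpa using hB
  have hq : 0 < (y + y⁻¹) ^ (n + 1) := by positivity
  have hM := (mul_le_mul hA hB' (by positivity) (le_trans (by positivity) hA)).trans hF
  refine le_of_mul_le_mul_left ?_ hq
  refine le_trans (le_of_eq ?_) hM
  have : y + y⁻¹ ≠ 0 := by positivity
  rw [pow_succ (y + y⁻¹) n]
  generalize y + y⁻¹ = q at *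
  field_simp

/-- The growth rate of `B_n(y)` for `y > 1`. -/
theorem bridge_growth (y : ℝ) (hy : 1 < y) :
    Tendsto (fun n : ℕ => Real.log (Bn n y) / n) atTop
      (nhds (Real.log (y ^ 2 + 1) - Real.log y)) := by
  have hy0 : 0 < y := by linarith
  have hr : 0 < 1 - y⁻¹ ^ 2 := by
    have : y⁻¹ < 1 := inv_lt_one_of_one_lt₀ hy
    have : 0 < y⁻¹ := by positivity
    nlinarith
  have hq : 0 < y + y⁻¹ := by positivity
  have hL : Real.log (y ^ 2 + 1) - Real.log y = Real.log (y + y⁻¹) := by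
    rw [← Real.log_div (by positivity) (by positivity)]
    congr 1
    field_simp
  rw [hL]
  obtain ⟨c, hc, hlow⟩ : ∃ c : ℝ, 0 < c ∧ ∀ n : ℕ, 1 ≤ n → c * (y + y⁻¹) ^ n ≤ Bn n y :=
    ⟨_, by positivity, fun n hn => Bn_lower hy n hn⟩
  have h1 : Tendsto (fun n : ℕ => Real.log c / n + Real.log (y + y⁻¹)) atTop
      (nhds (Real.log (y + y⁻¹))) := by
    simpa using (tendsto_const_div_atTop_nhds_zero_nat (Real.log c)).add_const
      (Real.log (y + y⁻¹))
  refine tendsto_of_tendsto_of_tendsto_of_le_of_le' h1 tendsto_const_nhds ?_ ?_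
  · filter_upwards [eventually_ge_atTop 1] with n hn
    have hn0 : (0 : ℝ) < n := by exact_mod_cast hn
    have h := Real.log_le_log (by positivity) (hlow n hn)
    rw [Real.log_mul hc.ne' (by positivity), Real.log_pow] at h
    rw [le_div_iff₀ hn0]
    refine le_trans (le_of_eq ?_) h
    field_simp
  · filter_upwards [eventually_ge_atTop 1] with n hn
    have hn0 : (0 : ℝ) < n := by exact_mod_cast hn
    have hpos : 0 < Bn n y := lt_of_lt_of_le (by positivity) (hlow n hn)
    have h := Real.log_le_log hpos (Bn_upper hy n hn)
    rw [Real.log_pow] at h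
    rw [div_le_iff₀ hn0]
    linarith
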